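/- Let p be a polynomial with real coefficients, let x ∈ ℝ, and let h ≠ 0. Working in the ring of hyper-dual numbers ℝ[ε₁, ε₂] with two commuting nilpotent imaginary units satisfying ε₁² = 0, ε₂² = 0, and ε₁ε₂ = ε₂ε₁ ≠ 0 (realized as the iterated dual numbers DualNumber(DualNumber ℝ)), the ε₁ε₂-component of the evaluation of p at x + ε₁h + ε₂h equals h²·p″(x); consequently the hyper-dual second-derivative formula Ep₁,₂[p(x + ε₁h + ε₂h)]/h² equals p″(x) exactly. -/

import Mathlib

open Polynomial

set_option synthInstance.maxHeartbeats 1000000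

/-- The first nilpotent imaginary unit `ε₁` of the hyper-dual numbers, realized as the
iterated dual numbers `DualNumber (DualNumber ℝ)`. -/
noncomputable def hdEps1 : DualNumber (DualNumber ℝ) := TrivSqZeroExt.inl DualNumber.eps

/-- The second nilpotent imaginary unit `ε₂` of the hyper-dual numbers. -/
noncomputable def hdEps2 : DualNumber (DualNumber ℝ) := DualNumber.eps

theorem hdEps1_sq : hdEps1 ^ 2 = 0 := by
  rw [hdEps1, sq, ← TrivSqZeroExt.inl_mul, DualNumber.eps_mul_eps, TrivSqZeroExt.inl_zero]

theorem hdEps2_sq : hdEps2 ^ 2 = 0 :=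
  DualNumber.eps_pow_two

theorem snd_snd_hdEps1_mul_hdEps2 : (hdEps1 * hdEps2).snd.snd = 1 := by
  simp [hdEps1, hdEps2]

theorem algebraMap_hyperdual (r : ℝ) :
    algebraMap ℝ (DualNumber (DualNumber ℝ)) r = TrivSqZeroExt.inl (TrivSqZeroExt.inl r) :=
  rfl

/-- The Taylor expansion of a polynomial in two directions of square zero. -/
theorem aeval_algebraMap_add_add_of_sq_eq_zero {R S : Type*} [CommRing R] [CommRing S]
    [Algebra R S] (p : Polynomial R) (x : R) (a b : S) (ha : a ^ 2 = 0) (hb : b ^ 2 = 0) :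
    Polynomial.aeval (algebraMap R S x + a + b) p =
      algebraMap R S (p.eval x) + algebraMap R S (p.derivative.eval x) * a +
        (algebraMap R S (p.derivative.eval x) +
          algebraMap R S (p.derivative.derivative.eval x) * a) * b := by
  rw [Polynomial.aeval_add_of_sq_eq_zero _ _ _ hb, Polynomial.aeval_add_of_sq_eq_zero _ _ _ ha,
    Polynomial.aeval_add_of_sq_eq_zero _ _ _ ha]
  simp only [Polynomial.aeval_algebraMap_apply_eq_algebraMap_eval]

/-- The `ε₁ε₂`-component of `p(x + ε₁h + ε₂h)` is `h² p″(x)`. -/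
theorem snd_snd_aeval_hyperdual (p : Polynomial ℝ) (x h : ℝ) :
    (Polynomial.aeval
        (algebraMap ℝ (DualNumber (DualNumber ℝ)) x
          + algebraMap ℝ (DualNumber (DualNumber ℝ)) h * hdEps1
          + algebraMap ℝ (DualNumber (DualNumber ℝ)) h * hdEps2) p).snd.snd
      = h ^ 2 * (Polynomial.derivative (Polynomial.derivative p)).eval x := by
  have h1 : (algebraMap ℝ (DualNumber (DualNumber ℝ)) h * hdEps1) ^ 2 = 0 := by
    rw [Commute.mul_pow (Algebra.commutes h hdEps1), hdEps1_sq, mul_zero]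
  have h2 : (algebraMap ℝ (DualNumber (DualNumber ℝ)) h * hdEps2) ^ 2 = 0 := by
    rw [Commute.mul_pow (Algebra.commutes h hdEps2), hdEps2_sq, mul_zero]
  refine (congrArg (fun z : DualNumber (DualNumber ℝ) => z.snd.snd)
    (aeval_algebraMap_add_add_of_sq_eq_zero p x _ _ h1 h2)).trans ?_
  simp [algebraMap_hyperdual, hdEps1, hdEps2]
  ring

/-- In the hyper-dual numbers `ℝ[ε₁, ε₂]` (with `ε₁² = 0`, `ε₂² = 0`,
`ε₁ε₂ = ε₂ε₁ ≠ 0`), the `ε₁ε₂`-component of `p(x + ε₁h + ε₂h)` equals `h²·p″(x)`;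
hence the hyper-dual second-derivative formula is exact. -/
theorem hyperdual_second_derivative_exact (p : Polynomial ℝ) (x h : ℝ) (hh : h ≠ 0) :
    hdEps1 ^ 2 = 0 ∧ hdEps2 ^ 2 = 0 ∧ hdEps1 * hdEps2 = hdEps2 * hdEps1 ∧
    hdEps1 * hdEps2 ≠ 0 ∧
    ((Polynomial.aeval
        (algebraMap ℝ (DualNumber (DualNumber ℝ)) x
          + algebraMap ℝ (DualNumber (DualNumber ℝ)) h * hdEps1
          + algebraMap ℝ (DualNumber (DualNumber ℝ)) h * hdEps2) p).snd.snd
      = h ^ 2 * (Polynomial.derivative (Polynomial.derivative p)).eval x) ∧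
    ((Polynomial.aeval
        (algebraMap ℝ (DualNumber (DualNumber ℝ)) x
          + algebraMap ℝ (DualNumber (DualNumber ℝ)) h * hdEps1
          + algebraMap ℝ (DualNumber (DualNumber ℝ)) h * hdEps2) p).snd.snd / h ^ 2
      = (Polynomial.derivative (Polynomial.derivative p)).eval x) := by
  refine ⟨hdEps1_sq, hdEps2_sq, mul_comm hdEps1 hdEps2, fun h0 => ?_, snd_snd_aeval_hyperdual p x h, ?_⟩
  · have h1 := snd_snd_hdEps1_mul_hdEps2
    rw [h0] at h1
    simp at h1
  · rw [snd_snd_aeval_hyperdual, mul_div_cancel_left₀ _ (pow_ne_zero 2 hh)]
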